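/- Let σ > 0, μ ∈ ℝ, γ ≠ 1, λ ∈ (0,1), Δ₀, Δ' ∈ ℝ, 0 < L₀ < U₀, k := μ/((1/2)σ²). Let V₀ be twice continuously differentiable on [L₀,U₀], satisfying (1/2)σ²ζ²V₀'' + μζV₀' − (1−γ)Δ₀V₀ = 0 on [L₀,U₀] with boundary conditions (1+L₀)V₀'(L₀) − (1−γ)V₀(L₀) = 0 and (1/(1−λ)+U₀)V₀'(U₀) − (1−γ)V₀(U₀) = 0, and set w(ζ) := ζ^{k−2}V₀(ζ). Let ν (the Vega) be twice continuously differentiable on [L₀,U₀], satisfying (1/2)σ²ζ²ν'' + μζν' − (1−γ)Δ₀ν = −σζ²V₀''(ζ) + (1−γ)Δ'V₀ on [L₀,U₀] with boundary conditions (1+L₀)ν'(L₀) − (1−γ)ν(L₀) = 0 and (1/(1−λ)+U₀)ν'(U₀) − (1−γ)ν(U₀) = 0. If ∫_{L₀}^{U₀} w(ζ)V₀(ζ) dζ ≠ 0, then Δ' = σ·( ∫_{L₀}^{U₀} w(ζ)ζ²V₀''(ζ) dζ ) / ( (1−γ)·∫_{L₀}^{U₀} w(ζ)V₀(ζ) dζ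 ). -/

import Mathlib

/-- A `C²` function is twice differentiable with continuous second derivative at the point. -/
lemma ContDiffAt.hasDerivAt_deriv_of_two {f : ℝ → ℝ} {x : ℝ} (hf : ContDiffAt ℝ 2 f x) :
    HasDerivAt f (deriv f x) x ∧ HasDerivAt (deriv f) (deriv (deriv f) x) x ∧
      ContinuousAt (deriv (deriv f)) x := by
  have h1 : ContDiffAt ℝ 1 (deriv f) x := hf.derivWithin (by norm_num [one_add_one_eq_two])
  have h0 : ContDiffAt ℝ 0 (deriv (deriv f)) x := h1.derivWithin (by norm_num)
  exact ⟨(hf.differentiableAt (by norm_num)).hasDerivAt,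
    (h1.differentiableAt (by norm_num)).hasDerivAt, h0.continuousAt⟩

/-- The Wronskian of two functions satisfying the same Robin condition vanishes. -/
lemma wronskian_eq_zero_of_robin {a c u u' v v' : ℝ} (ha : a ≠ 0)
    (hu : a * u' - c * u = 0) (hv : a * v' - c * v = 0) : u * v' - v * u' = 0 := by
  apply mul_left_cancel₀ ha
  linear_combination u * hv - v * hu

/-- Lagrange's identity for the Euler operator `½σ²x²D² + μxD`. -/
lemma hasDerivAt_rpow_mul_wronskian {σ μ k x : ℝ} {u v : ℝ → ℝ} (hx : 0 < x)
    (hk : 1 / 2 * σ ^ 2 * k = μ) (hu : ContDiffAt ℝ 2 u x) (hv : ContDiffAt ℝ 2 v x) :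
    HasDerivAt (fun y ↦ 1 / 2 * σ ^ 2 * (y ^ k * (u y * deriv v y - v y * deriv u y)))
      (x ^ (k - 2) *
        (u x * (1 / 2 * σ ^ 2 * x ^ 2 * deriv (deriv v) x + μ * x * deriv v x) -
          v x * (1 / 2 * σ ^ 2 * x ^ 2 * deriv (deriv u) x + μ * x * deriv u x))) x := by
  obtain ⟨hu1, hu2, -⟩ := hu.hasDerivAt_deriv_of_two
  obtain ⟨hv1, hv2, -⟩ := hv.hasDerivAt_deriv_of_two
  have hp : HasDerivAt (fun y : ℝ ↦ y ^ k) (k * x ^ (k - 1)) x :=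
    Real.hasDerivAt_rpow_const (Or.inl hx.ne')
  have e1 : x ^ (k - 1) = x ^ (k - 2) * x := by
    rw [← Real.rpow_add_one hx.ne']; ring_nf
  have e2 : x ^ k = x ^ (k - 2) * x ^ 2 := by
    rw [← Real.rpow_natCast x 2, ← Real.rpow_add hx]; norm_num
  refine ((hp.mul ((hu1.mul hv2).sub (hv1.mul hu2))).const_mul (1 / 2 * σ ^ 2)).congr_deriv ?_
  simp only [Pi.mul_apply, Pi.sub_apply]
  rw [e1, e2, ← hk]
  ring


/-- Fredholm solvability condition for the slow-scale Vega: if `V₀` solves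
the constant-volatility no-trade problem with eigenvalue `Δ₀` and free boundaries
`L₀ < U₀`, `w(ζ) = ζ^{k−2}V₀(ζ)` with `k = μ/((1/2)σ²)`, and the Vega `ν` solves the
inhomogeneous equation with source `−σζ²V₀'' + (1−γ)Δ'V₀` and homogeneous boundary
conditions, then `Δ' = σ·∫ w ζ²V₀'' / ((1−γ)·∫ w V₀)`. -/
theorem slow_scale_vega_delta_prime (σ μ γ lam Δ₀ Δ' L₀ U₀ k : ℝ) (V₀ ν : ℝ → ℝ)
    (hσ : 0 < σ) (hγ1 : γ ≠ 1) (hlam0 : 0 < lam) (hlam1 : lam < 1)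
    (hL : 0 < L₀) (hLU : L₀ < U₀) (hk : k = μ / ((1/2) * σ^2))
    (hV0 : ∀ x ∈ Set.Icc L₀ U₀, ContDiffAt ℝ 2 V₀ x)
    (hODE0 : ∀ ζ ∈ Set.Icc L₀ U₀,
      (1/2) * σ^2 * ζ^2 * deriv (deriv V₀) ζ + μ * ζ * deriv V₀ ζ - (1 - γ) * Δ₀ * V₀ ζ = 0)
    (hbc0L : (1 + L₀) * deriv V₀ L₀ - (1 - γ) * V₀ L₀ = 0)
    (hbc0U : (1 / (1 - lam) + U₀) * deriv V₀ U₀ - (1 - γ) * V₀ U₀ = 0)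
    (hν : ∀ x ∈ Set.Icc L₀ U₀, ContDiffAt ℝ 2 ν x)
    (hODEν : ∀ ζ ∈ Set.Icc L₀ U₀,
      (1/2) * σ^2 * ζ^2 * deriv (deriv ν) ζ + μ * ζ * deriv ν ζ - (1 - γ) * Δ₀ * ν ζ
        = -σ * ζ^2 * deriv (deriv V₀) ζ + (1 - γ) * Δ' * V₀ ζ)
    (hbcνL : (1 + L₀) * deriv ν L₀ - (1 - γ) * ν L₀ = 0)
    (hbcνU : (1 / (1 - lam) + U₀) * deriv ν U₀ - (1 - γ) * ν U₀ = 0)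
    (hden : (∫ ζ in L₀..U₀, (ζ ^ (k - 2) * V₀ ζ) * V₀ ζ) ≠ 0) :
    Δ' = σ * (∫ ζ in L₀..U₀, (ζ ^ (k - 2) * V₀ ζ) * (ζ^2 * deriv (deriv V₀) ζ))
      / ((1 - γ) * ∫ ζ in L₀..U₀, (ζ ^ (k - 2) * V₀ ζ) * V₀ ζ) := by
  have huIcc : Set.uIcc L₀ U₀ = Set.Icc L₀ U₀ := Set.uIcc_of_le hLU.le
  have hpos : ∀ x ∈ Set.Icc L₀ U₀, 0 < x := fun x hx ↦ hL.trans_le hx.1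
  have hk' : 1 / 2 * σ ^ 2 * k = μ := by
    rw [hk]; field_simp
  have hw : ContinuousOn (fun ζ ↦ ζ ^ (k - 2) * V₀ ζ) (Set.uIcc L₀ U₀) := by
    rw [huIcc]
    intro x hx
    exact ((Real.continuousAt_rpow_const x (k - 2) (Or.inl (hpos x hx).ne')).mul
      (hV0 x hx).continuousAt).continuousWithinAt
  have hwV : ContinuousOn (fun ζ ↦ (ζ ^ (k - 2) * V₀ ζ) * V₀ ζ) (Set.uIcc L₀ U₀) :=
    hw.mul fun x hx ↦ (hV0 x (huIcc ▸ hx)).continuousAt.continuousWithinAt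
  have hwD : ContinuousOn (fun ζ ↦ (ζ ^ (k - 2) * V₀ ζ) * (ζ ^ 2 * deriv (deriv V₀) ζ))
      (Set.uIcc L₀ U₀) :=
    hw.mul ((continuousOn_pow 2).mul fun x hx ↦
      (hV0 x (huIcc ▸ hx)).hasDerivAt_deriv_of_two.2.2.continuousWithinAt)
  have hA := hwV.intervalIntegrable (μ := MeasureTheory.volume)
  have hB := hwD.intervalIntegrable (μ := MeasureTheory.volume)
  have hFTC := intervalIntegral.integral_eq_sub_of_hasDerivAt
    (f := fun y ↦ 1 / 2 * σ ^ 2 * (y ^ k * (V₀ y * deriv ν y - ν y * deriv V₀ y)))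
    (f' := fun ζ ↦ (1 - γ) * Δ' * ((ζ ^ (k - 2) * V₀ ζ) * V₀ ζ) -
      σ * ((ζ ^ (k - 2) * V₀ ζ) * (ζ ^ 2 * deriv (deriv V₀) ζ)))
    (fun x hx ↦ by
      rw [huIcc] at hx
      refine (hasDerivAt_rpow_mul_wronskian (hpos x hx) hk' (hV0 x hx) (hν x hx)).congr_deriv ?_
      linear_combination x ^ (k - 2) * V₀ x * hODEν x hx - x ^ (k - 2) * ν x * hODE0 x hx)
    ((hA.const_mul _).sub (hB.const_mul _))
  have hU : 1 / (1 - lam) + U₀ ≠ 0 := by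
    have h1 : 0 < 1 / (1 - lam) := one_div_pos.mpr (sub_pos.mpr hlam1)
    linarith
  rw [intervalIntegral.integral_sub (hA.const_mul _) (hB.const_mul _),
    intervalIntegral.integral_const_mul, intervalIntegral.integral_const_mul,
    wronskian_eq_zero_of_robin (by linarith) hbc0L hbcνL,
    wronskian_eq_zero_of_robin hU hbc0U hbcνU] at hFTC
  rw [eq_div_iff (mul_ne_zero (sub_ne_zero.mpr hγ1.symm) hden)]
  linear_combination hFTC
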